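/- Let B ∈ ℝ^{n×d} and let η be a Gaussian vector in ℝ^d with independent coordinates each distributed N(0, σ²), σ > 0. Then E[‖Bη‖₂⁴ ‖η‖₂²] = σ⁶ ((d+4) ‖B‖_F⁴ + (2d+8) ‖BᵀB‖_F²), and E[‖Bη‖₂² ‖η‖₂²] = σ⁴ (d+2) ‖B‖_F². -/

import Mathlib

open MeasureTheory ProbabilityTheory Matrix
open scoped NNReal

lemma integrable_pow_gaussianReal (v : ℝ≥0) (k : ℕ) :
    Integrable (fun x : ℝ => x ^ k) (gaussianReal 0 v) := by
  have h := (memLp_id_gaussianReal (μ := 0) (v := v) k).integrable_norm_pow'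
  refine h.mono' (by fun_prop) (ae_of_all _ fun x => ?_)
  simp

lemma hasDerivAt_gaussianPDFReal {v : ℝ≥0} (hv : v ≠ 0) (x : ℝ) :
    HasDerivAt (gaussianPDFReal 0 v) (-(x / v) * gaussianPDFReal 0 v x) x := by
  have hv' : (v : ℝ) ≠ 0 := by exact_mod_cast hv
  have h : HasDerivAt (fun y : ℝ => -(y - 0) ^ 2 / (2 * v)) (-(x / v)) x := by
    have := ((((hasDerivAt_id x).sub_const 0).pow 2).neg).div_const (2 * (v : ℝ))
    convert! this using 1
    simp
    field_simp
  have h2 := h.exp.const_mul (√(2 * Real.pi * v))⁻¹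
  rw [gaussianPDFReal_def]
  convert! h2 using 1
  ring

/-- Stein's recursion for the moments of a centred real Gaussian. -/
lemma integral_pow_succ_gaussianReal (v : ℝ≥0) (k : ℕ) :
    ∫ x, x ^ (k + 1) ∂(gaussianReal 0 v)
      = v * (k * ∫ x, x ^ (k - 1) ∂(gaussianReal 0 v)) := by
  by_cases hv : v = 0
  · simp [hv]
  have hv' : (v : ℝ) ≠ 0 := by exact_mod_cast hv
  have hpdf (m : ℕ) : Integrable (fun x : ℝ => gaussianPDFReal 0 v x * x ^ m) := by
    have h := integrable_pow_gaussianReal v m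
    rw [gaussianReal_of_var_ne_zero _ hv, integrable_withDensity_iff_integrable_smul'
      (measurable_gaussianPDF _ _) (ae_of_all _ fun _ => gaussianPDF_lt_top)] at h
    simpa [toReal_gaussianPDF] using h
  have key := integral_eq_zero_of_hasDerivAt_of_integrable
    (f := fun x : ℝ => gaussianPDFReal 0 v x * x ^ k)
    (f' := fun x : ℝ => k * (gaussianPDFReal 0 v x * x ^ (k - 1))
      - (v : ℝ)⁻¹ * (gaussianPDFReal 0 v x * x ^ (k + 1)))
    (fun x => by
      convert! (hasDerivAt_gaussianPDFReal hv x).mul (hasDerivAt_pow k x) using 1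
      rw [pow_succ]
      ring)
    (((hpdf _).const_mul _).sub ((hpdf _).const_mul _)) (hpdf k)
  rw [integral_sub ((hpdf _).const_mul _) ((hpdf _).const_mul _), integral_const_mul,
    integral_const_mul] at key
  simp only [integral_gaussianReal_eq_integral_smul hv, smul_eq_mul]
  field_simp at key
  linarith

section GaussianPolynomial

open MvPolynomial

variable {ι : Type*} [Fintype ι]

lemma integrable_eval_gaussian (v : ℝ≥0) (p : MvPolynomial ι ℝ) :
    Integrable (fun η : ι → ℝ => eval η p) (Measure.pi fun _ => gaussianReal 0 v) := by
  induction p using MvPolynomial.induction_on' with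
  | monomial s a =>
    simp only [eval_monomial, Finsupp.prod_fintype _ _ (fun _ => pow_zero _)]
    exact (Integrable.fintype_prod (fun i => integrable_pow_gaussianReal v (s i))).const_mul a
  | add p q hp hq =>
    simp only [map_add]
    exact hp.add hq

/-- The expectation of a polynomial in independent centred Gaussians of variance `v`. -/
noncomputable def gaussianExpectation (v : ℝ≥0) : MvPolynomial ι ℝ →ₗ[ℝ] ℝ where
  toFun p := ∫ η : ι → ℝ, eval η p ∂(Measure.pi fun _ => gaussianReal 0 v)
  map_add' p q := by
    simp only [map_add]
    exact integral_add (integrable_eval_gaussian v p) (integrable_eval_gaussian v q)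
  map_smul' c p := by
    simp only [smul_eval, RingHom.id_apply, smul_eq_mul]
    exact integral_const_mul _ _

lemma gaussianExpectation_monomial (v : ℝ≥0) (s : ι →₀ ℕ) (a : ℝ) :
    gaussianExpectation v (monomial s a)
      = a * ∏ i, ∫ x, x ^ s i ∂(gaussianReal 0 v) := by
  simp only [gaussianExpectation, LinearMap.coe_mk, AddHom.coe_mk, eval_monomial,
    Finsupp.prod_fintype _ _ (fun _ => pow_zero _)]
  rw [integral_const_mul, integral_fintype_prod_eq_prod (f := fun i x => x ^ s i)]

lemma gaussianExpectation_one (v : ℝ≥0) :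
    gaussianExpectation v (1 : MvPolynomial ι ℝ) = 1 := by
  simp [gaussianExpectation]

lemma gaussianExpectation_C_mul (v : ℝ≥0) (a : ℝ) (p : MvPolynomial ι ℝ) :
    gaussianExpectation v (C a * p) = a * gaussianExpectation v p := by
  rw [C_mul', map_smul, smul_eq_mul]

/-- Gaussian integration by parts for polynomials. -/
lemma gaussianExpectation_X_mul (v : ℝ≥0) (i : ι) (p : MvPolynomial ι ℝ) :
    gaussianExpectation v (X i * p) = v * gaussianExpectation v (pderiv i p) := by
  classical
  induction p using MvPolynomial.induction_on' with
  | monomial s a =>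
    rw [mul_comm, ← pow_one (X i), ← monomial_add_single, pderiv_monomial,
      gaussianExpectation_monomial, gaussianExpectation_monomial,
      ← Finset.mul_prod_erase _ _ (Finset.mem_univ i),
      ← Finset.mul_prod_erase _ _ (Finset.mem_univ i)]
    have h1 : ∀ j ∈ Finset.univ.erase i,
        ∫ x, x ^ (s + Finsupp.single i 1 : ι →₀ ℕ) j ∂(gaussianReal 0 v)
          = ∫ x, x ^ (s - Finsupp.single i 1 : ι →₀ ℕ) j ∂(gaussianReal 0 v) := by
      intro j hj
      have : i ≠ j := (Finset.ne_of_mem_erase hj).symm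
      simp [this]
    rw [Finset.prod_congr rfl h1]
    simp only [Finsupp.add_apply, Finsupp.tsub_apply, Finsupp.single_eq_same]
    rw [integral_pow_succ_gaussianReal]
    ring
  | add p q hp hq => rw [mul_add, map_add, map_add, map_add, hp, hq, mul_add]

lemma gaussianExpectation_mul_sum_X_sq (v : ℝ≥0) {p : MvPolynomial ι ℝ} {m : ℕ}
    (hp : p.IsHomogeneous m) :
    gaussianExpectation v (p * ∑ i, X i ^ 2)
      = v * ((Fintype.card ι + m) * gaussianExpectation v p) := by
  have h1 : p * ∑ i, X i ^ 2 = ∑ i, X i * (X i * p) := by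
    rw [Finset.mul_sum]
    exact Finset.sum_congr rfl fun i _ => by ring
  have h2 (i : ι) : gaussianExpectation v (X i * (X i * p))
      = v * (gaussianExpectation v p + gaussianExpectation v (X i * pderiv i p)) := by
    rw [gaussianExpectation_X_mul, pderiv_mul, pderiv_X_self, one_mul, map_add]
  rw [h1, map_sum]
  simp only [h2]
  rw [← Finset.mul_sum, Finset.sum_add_distrib, Finset.sum_const, ← map_sum,
    hp.sum_X_mul_pderiv, map_nsmul]
  simp only [nsmul_eq_mul, Finset.card_univ]
  ring

/-- The `i`-th coordinate of `A *ᵥ X`. -/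
noncomputable def linearPoly (A : Matrix ι ι ℝ) (i : ι) : MvPolynomial ι ℝ :=
  ∑ j, C (A i j) * X j

/-- The quadratic form of `A`. -/
noncomputable def quadraticPoly (A : Matrix ι ι ℝ) : MvPolynomial ι ℝ :=
  ∑ i, X i * linearPoly A i

lemma isHomogeneous_quadraticPoly (A : Matrix ι ι ℝ) : (quadraticPoly A).IsHomogeneous 2 := by
  refine IsHomogeneous.sum _ _ _ fun i _ => (isHomogeneous_X ℝ i).mul (n := 1) ?_
  refine IsHomogeneous.sum _ _ _ fun j _ => ?_
  simpa using (isHomogeneous_C ι (A i j)).mul (isHomogeneous_X ℝ j)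

lemma pderiv_linearPoly (A : Matrix ι ι ℝ) (i k : ι) :
    pderiv k (linearPoly A i) = C (A i k) := by
  classical
  simp [linearPoly, pderiv_X, Pi.single_apply]

lemma pderiv_quadraticPoly {A : Matrix ι ι ℝ} (hA : A.IsSymm) (k : ι) :
    pderiv k (quadraticPoly A) = 2 * linearPoly A k := by
  classical
  have h : ∑ i, X i * C (A i k) = linearPoly A k :=
    Finset.sum_congr rfl fun i _ => by rw [← hA.apply i k, mul_comm]
  simp only [quadraticPoly, map_sum, pderiv_mul, pderiv_linearPoly, Finset.sum_add_distrib, h]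
  simp [pderiv_X, Pi.single_apply, two_mul]

lemma gaussianExpectation_quadraticPoly (v : ℝ≥0) (A : Matrix ι ι ℝ) :
    gaussianExpectation v (quadraticPoly A) = v * A.trace := by
  simp only [quadraticPoly, map_sum, gaussianExpectation_X_mul, pderiv_linearPoly,
    Matrix.trace, Matrix.diag, Finset.mul_sum]
  refine Finset.sum_congr rfl fun i _ => ?_
  rw [← mul_one (C _), gaussianExpectation_C_mul, gaussianExpectation_one, mul_one]

lemma gaussianExpectation_linearPoly_mul_self (v : ℝ≥0) (A : Matrix ι ι ℝ) (i : ι) :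
    gaussianExpectation v (linearPoly A i * linearPoly A i) = v * ∑ j, A i j ^ 2 := by
  conv_lhs => enter [2, 1]; rw [linearPoly]
  simp only [Finset.sum_mul, map_sum, mul_assoc, gaussianExpectation_C_mul,
    gaussianExpectation_X_mul, pderiv_linearPoly, Finset.mul_sum]
  refine Finset.sum_congr rfl fun j _ => ?_
  rw [← mul_one (C _), gaussianExpectation_C_mul, gaussianExpectation_one]
  ring

lemma gaussianExpectation_quadraticPoly_sq (v : ℝ≥0) {A : Matrix ι ι ℝ} (hA : A.IsSymm) :
    gaussianExpectation v (quadraticPoly A ^ 2)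
      = v ^ 2 * (A.trace ^ 2 + 2 * (Aᵀ * A).trace) := by
  have h1 : quadraticPoly A ^ 2 = ∑ i, X i * (linearPoly A i * quadraticPoly A) := by
    simp only [← mul_assoc]
    rw [← Finset.sum_mul, sq]
    rfl
  have h2 : (Aᵀ * A).trace = ∑ i, ∑ j, A i j ^ 2 := by
    simp only [Matrix.trace, Matrix.diag, Matrix.mul_apply, Matrix.transpose_apply, ← sq]
    exact Finset.sum_comm
  have h3 (i : ι) : linearPoly A i * (2 * linearPoly A i)
      = C 2 * (linearPoly A i * linearPoly A i) := by
    rw [map_ofNat]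
    ring
  simp only [h1, map_sum, gaussianExpectation_X_mul, pderiv_mul, pderiv_linearPoly,
    pderiv_quadraticPoly hA, map_add, h3, gaussianExpectation_C_mul,
    gaussianExpectation_quadraticPoly, gaussianExpectation_linearPoly_mul_self]
  rw [h2, ← Finset.mul_sum, Finset.sum_add_distrib, ← Finset.sum_mul, ← Finset.mul_sum,
    ← Finset.mul_sum]
  change _ * (A.trace * _ + _) = _
  ring

lemma eval_quadraticPoly (A : Matrix ι ι ℝ) (η : ι → ℝ) :
    eval η (quadraticPoly A) = η ⬝ᵥ A *ᵥ η := by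
  simp [quadraticPoly, linearPoly, dotProduct, mulVec]

end GaussianPolynomial

/-- **Mixed Gaussian moments of `‖Bη‖₂` and `‖η‖₂`.**  For `η ~ N(0, σ² I_d)`,
`E[‖Bη‖₂⁴ ‖η‖₂²] = σ⁶ ((d+4) ‖B‖_F⁴ + (2d+8) ‖BᵀB‖_F²)` and
`E[‖Bη‖₂² ‖η‖₂²] = σ⁴ (d+2) ‖B‖_F²`, where `‖B‖_F² = Tr(BᵀB)`. -/
theorem gaussian_mixed_moments {n d : ℕ} (B : Matrix (Fin n) (Fin d) ℝ)
    (σ : ℝ) (hσ : 0 < σ) :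
    (∫ η : Fin d → ℝ,
        (∑ i, B.mulVec η i ^ 2) ^ 2 * (∑ i, η i ^ 2)
        ∂(Measure.pi fun _ : Fin d => gaussianReal 0 ⟨σ ^ 2, sq_nonneg σ⟩)
      = σ ^ 6 * (((d : ℝ) + 4) * (Bᵀ * B).trace ^ 2
          + (2 * d + 8) * ((Bᵀ * B)ᵀ * (Bᵀ * B)).trace)) ∧
    (∫ η : Fin d → ℝ,
        (∑ i, B.mulVec η i ^ 2) * (∑ i, η i ^ 2)
        ∂(Measure.pi fun _ : Fin d => gaussianReal 0 ⟨σ ^ 2, sq_nonneg σ⟩)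
      = σ ^ 4 * ((d : ℝ) + 2) * (Bᵀ * B).trace) := by
  set v : ℝ≥0 := ⟨σ ^ 2, sq_nonneg σ⟩
  have hv : (v : ℝ) = σ ^ 2 := rfl
  have hsymm : (Bᵀ * B).IsSymm := by
    rw [Matrix.IsSymm, transpose_mul, transpose_transpose]
  have hQ (η : Fin d → ℝ) :
      ∑ i, B.mulVec η i ^ 2 = MvPolynomial.eval η (quadraticPoly (Bᵀ * B)) := by
    rw [eval_quadraticPoly, ← mulVec_mulVec, dotProduct_mulVec, vecMul_transpose]
    simp [dotProduct, sq]
  have hN (η : Fin d → ℝ) :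
      ∑ i, η i ^ 2 = MvPolynomial.eval η (∑ i, MvPolynomial.X i ^ 2) := by simp
  simp only [hQ, hN, ← map_pow, ← map_mul]
  have h2 := isHomogeneous_quadraticPoly (Bᵀ * B)
  constructor
  · refine (gaussianExpectation_mul_sum_X_sq v (h2.pow 2)).trans ?_
    rw [gaussianExpectation_quadraticPoly_sq v hsymm, hv, Fintype.card_fin]
    push_cast
    ring
  · refine (gaussianExpectation_mul_sum_X_sq v h2).trans ?_
    rw [gaussianExpectation_quadraticPoly, hv, Fintype.card_fin]
    push_cast
    ring
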